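/- Let H be a nontrivial real Hilbert space and Ω a nonempty bounded open subset of H with boundary ∂Ω. Define u : H → ℝ by u(x) = dist(x, ∂Ω) = inf{ ‖x − y‖ : y ∈ ∂Ω }. Then u is a viscosity solution of the eikonal equation ‖du(x)‖ = 1 on Ω with u = 0 on ∂Ω; more precisely: u is continuous, u(x) = 0 for all x ∈ ∂Ω, and for every x ∈ Ω one has ‖ζ‖ ≥ 1 for all ζ ∈ D⁻u(x) and ‖ζ‖ ≤ 1 for all ζ ∈ D⁺u(x). Moreover it is the unique such solution: if w : H → ℝ is continuous, w(x) = 0 for every x ∈ H \ Ω, and for every x ∈ Ω one has ‖ζ‖ ≥ 1 for all ζ ∈ D⁻w(x) and ‖ζ‖ ≤ 1 for all ζ ∈ D⁺w(x), then w(x) = dist(x, ∂Ω) for every x in the closure of Ω. -/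

import Mathlib

open Filter Topology Metric

/-- The viscosity subdifferential of `f : H → ℝ` at `p`. -/
def subdiffR {H : Type*} [NormedAddCommGroup H] [InnerProductSpace ℝ H]
    (f : H → ℝ) (p : H) : Set (H →L[ℝ] ℝ) :=
  {ζ | ∃ φ : H → ℝ, ContDiff ℝ 1 φ ∧ fderiv ℝ φ p = ζ ∧
    IsLocalMin (fun x => f x - φ x) p}

/-- The viscosity superdifferential of `f : H → ℝ` at `p`. -/
def superdiffR {H : Type*} [NormedAddCommGroup H] [InnerProductSpace ℝ H]
    (f : H → ℝ) (p : H) : Set (H →L[ℝ] ℝ) :=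
  {ζ | ∃ φ : H → ℝ, ContDiff ℝ 1 φ ∧ fderiv ℝ φ p = ζ ∧
    IsLocalMax (fun x => f x - φ x) p}

theorem le_apply_of_eventually_le {H : Type*} [NormedAddCommGroup H] [NormedSpace ℝ H]
    {φ : H → ℝ} {ζ : H →L[ℝ] ℝ} {z v : H} {C : ℝ} (hφ : HasFDerivAt φ ζ z)
    (h : ∀ᶠ t : ℝ in 𝓝[>] 0, C * t ≤ φ (z + t • v) - φ z) : C ≤ ζ v := by
  have h1 : HasDerivAt (fun t : ℝ => φ (z + t • v)) (ζ v) 0 := hφ.hasLineDerivAt v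
  have h2 := (hasDerivAt_iff_tendsto_slope.1 h1).mono_left
    (nhdsWithin_mono (0 : ℝ) (s := Set.Ioi 0) (fun t ht => ne_of_gt ht))
  refine ge_of_tendsto h2 ?_
  filter_upwards [h, self_mem_nhdsWithin] with t ht ht0
  have ht0 : 0 < t := ht0
  rw [slope_def_field]
  simp only [zero_smul, add_zero, sub_zero]
  rwa [le_div_iff₀ ht0]

theorem le_norm_of_eventually_le {H : Type*} [NormedAddCommGroup H] [NormedSpace ℝ H]
    {φ : H → ℝ} {ζ : H →L[ℝ] ℝ} {z v : H} {C : ℝ} (hφ : HasFDerivAt φ ζ z) (hv : ‖v‖ = 1)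
    (h : ∀ᶠ t : ℝ in 𝓝[>] 0, C * t ≤ φ (z + t • v) - φ z) : C ≤ ‖ζ‖ := by
  have := (le_apply_of_eventually_le hφ h).trans ((le_abs_self _).trans (ζ.le_opNorm v))
  rwa [hv, mul_one] at this

theorem norm_le_of_eventually_ge {H : Type*} [NormedAddCommGroup H] [NormedSpace ℝ H]
    {φ : H → ℝ} {ζ : H →L[ℝ] ℝ} {z : H} {C : ℝ} (hφ : HasFDerivAt φ ζ z) (hC : 0 ≤ C)
    (h : ∀ᶠ y in 𝓝 z, -(C * ‖y - z‖) ≤ φ y - φ z) : ‖ζ‖ ≤ C := by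
  have key : ∀ v : H, -(C * ‖v‖) ≤ ζ v := by
    intro v
    refine le_apply_of_eventually_le hφ ?_
    have hc : Tendsto (fun t : ℝ => z + t • v) (𝓝[>] 0) (𝓝 z) := by
      have : Continuous (fun t : ℝ => z + t • v) := by fun_prop
      simpa using (this.tendsto 0).mono_left nhdsWithin_le_nhds
    filter_upwards [hc.eventually h, self_mem_nhdsWithin] with t ht ht0
    have ht0 : 0 < t := ht0
    rw [add_sub_cancel_left, norm_smul, Real.norm_of_nonneg ht0.le] at ht
    linarith
  refine ζ.opNorm_le_bound hC fun v => ?_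
  rw [Real.norm_eq_abs, abs_le]
  refine ⟨key v, ?_⟩
  have := key (-v)
  rw [map_neg, norm_neg] at this
  linarith

/-- A function that is `C¹` at a point agrees near that point with a globally `C¹` function. -/
theorem exists_contDiff_eventuallyEq {H : Type*} [NormedAddCommGroup H] [InnerProductSpace ℝ H]
    {φ : H → ℝ} {z : H} (hφ : ContDiffAt ℝ 1 φ z) :
    ∃ ψ : H → ℝ, ContDiff ℝ 1 ψ ∧ ψ =ᶠ[𝓝 z] φ := by
  obtain ⟨r, hr, hball⟩ := Metric.eventually_nhds_iff_ball.1 (hφ.eventually (by simp))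
  let b : ContDiffBump z := ⟨r / 4, r / 2, by positivity, by linarith⟩
  refine ⟨fun y => b y * φ y, contDiff_iff_contDiffAt.2 fun y => ?_, ?_⟩
  · by_cases hy : y ∈ closedBall z (r / 2)
    · exact b.contDiff.contDiffAt.mul (hball y (closedBall_subset_ball (by linarith) hy))
    · have h0 : (fun y => b y * φ y) =ᶠ[𝓝 y] fun _ => 0 := by
        filter_upwards [isClosed_closedBall.isOpen_compl.mem_nhds hy] with x hx
        have : b x = 0 := b.zero_of_le_dist (not_le.1 (fun h => hx h)).le
        rw [this, zero_mul]
      exact contDiffAt_const.congr_of_eventuallyEq h0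
  · filter_upwards [b.eventuallyEq_one] with y hy
    simp [hy]

/-- A smooth variational principle: on a closed subset of a Hilbert space, a continuous function
bounded below attains its minimum after an arbitrarily small quadratic perturbation. -/
theorem exists_isMinOn_add_const_mul_norm_sub_sq {H : Type*} [NormedAddCommGroup H]
    [InnerProductSpace ℝ H] [CompleteSpace H] {C : Set H} (hC : IsClosed C) (hCne : C.Nonempty)
    {f : H → ℝ} (hf : Continuous f) (hfC : BddBelow (f '' C)) {c : ℝ} (hc : 0 < c) :
    ∃ b, ∃ z ∈ C, ‖z - b‖ ≤ 1 ∧ IsMinOn (fun x => f x + c * ‖x - b‖ ^ 2) C z := by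
  set q : ℕ → ℝ := fun k => 1 / 2 / 2 ^ k with hq
  have hq0 : ∀ k, 0 < q k := fun k => by simp only [hq]; positivity
  have hq1 : HasSum q 1 := hasSum_geometric_two' 1
  have hqt : Tendsto q atTop (𝓝 0) := hq1.summable.tendsto_atTop_zero
  have hpick : ∀ (g : H → ℝ) (x : H) (ε : ℝ), BddBelow (g '' C) → x ∈ C → 0 < ε →
      ∃ x' ∈ C, g x' ≤ g x ∧ ∀ y ∈ C, g x' ≤ g y + ε := by
    intro g x ε hg hx hε
    obtain ⟨_, ⟨p, hp, rfl⟩, hpl⟩ :=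
      exists_lt_of_csInf_lt (hCne.image g) (lt_add_of_pos_right (sInf (g '' C)) hε)
    have hle : ∀ y ∈ C, sInf (g '' C) ≤ g y := fun y hy => csInf_le hg ⟨y, hy, rfl⟩
    rcases le_total (g p) (g x) with h | h
    · exact ⟨p, hp, h, fun y hy => by linarith [hle y hy]⟩
    · exact ⟨x, hx, le_rfl, fun y hy => by linarith [hle y hy]⟩
  choose! pick hpickC hpickx hpickmin using hpick
  obtain ⟨p₀, hp₀⟩ := hCne
  let ε : ℕ → ℝ := fun k => c * q k * q k ^ 2
  have hε : ∀ k, 0 < ε k := fun k => by have := hq0 k; simp only [ε]; positivity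
  let step : ℕ → H × (H → ℝ) → H × (H → ℝ) := fun k s =>
    (pick (fun y => s.2 y + c * q k * ‖y - s.1‖ ^ 2) s.1 (ε (k + 1)),
      fun y => s.2 y + c * q k * ‖y - s.1‖ ^ 2)
  let s : ℕ → H × (H → ℝ) := fun n => Nat.rec (pick f p₀ (ε 0), f) step n
  let x : ℕ → H := fun n => (s n).1
  let g : ℕ → H → ℝ := fun n => (s n).2
  have hg0 : g 0 = f := rfl
  have hgs : ∀ k y, g (k + 1) y = g k y + c * q k * ‖y - x k‖ ^ 2 := fun k y => rfl
  have hx0 : x 0 = pick (g 0) p₀ (ε 0) := rfl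
  have hxs : ∀ k, x (k + 1) = pick (g (k + 1)) (x k) (ε (k + 1)) := fun k => rfl
  clear_value x g
  have hgmono : ∀ y, Monotone fun k => g k y := fun y => monotone_nat_of_le_succ fun k => by
    have := hq0 k
    rw [hgs]
    have : 0 ≤ c * q k * ‖y - x k‖ ^ 2 := by positivity
    linarith
  have hgcont : ∀ k, Continuous (g k) := by
    intro k
    induction k with
    | zero => rwa [hg0]
    | succ k ih =>
      have : g (k + 1) = fun y => g k y + c * q k * ‖y - x k‖ ^ 2 := funext (hgs k)
      rw [this]
      fun_prop
  have hgbdd : ∀ k, BddBelow (g k '' C) := by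
    obtain ⟨m, hm⟩ := hfC
    rintro k
    refine ⟨m, ?_⟩
    rintro _ ⟨y, hy, rfl⟩
    have h1 := hgmono y (Nat.zero_le k)
    have h2 := hm ⟨y, hy, rfl⟩
    simp only [hg0] at h1
    exact h2.trans h1
  have hxC : ∀ k, x k ∈ C := by
    intro k
    induction k with
    | zero => rw [hx0]; exact hpickC _ _ _ (hgbdd 0) hp₀ (hε 0)
    | succ k ih => rw [hxs]; exact hpickC _ _ _ (hgbdd _) ih (hε _)
  have hxmin : ∀ k, ∀ y ∈ C, g k (x k) ≤ g k y + ε k := by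
    intro k
    cases k with
    | zero => rw [hx0]; exact hpickmin _ _ _ (hgbdd 0) hp₀ (hε 0)
    | succ k => rw [hxs]; exact hpickmin _ _ _ (hgbdd _) (hxC k) (hε _)
  have hxdec : ∀ k, g (k + 1) (x (k + 1)) ≤ g k (x k) := by
    intro k
    have h1 : g (k + 1) (x (k + 1)) ≤ g (k + 1) (x k) := by
      rw [hxs]; exact hpickx _ _ _ (hgbdd _) (hxC k) (hε _)
    simpa [hgs k (x k)] using h1
  have hanti : Antitone fun k => g k (x k) := antitone_nat_of_succ_le hxdec
  have hdist : ∀ k, dist (x k) (x (k + 1)) ≤ 1 / 2 / 2 ^ k := by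
    intro k
    have h1 := hxdec k
    have h2 := hxmin k _ (hxC (k + 1))
    rw [hgs] at h1
    have h3 : (c * q k) * ‖x (k + 1) - x k‖ ^ 2 ≤ (c * q k) * q k ^ 2 := by
      simp only [ε] at h2
      linarith
    have h4 := le_of_mul_le_mul_left h3 (mul_pos hc (hq0 k))
    rw [dist_comm, dist_eq_norm]
    exact le_of_sq_le_sq h4 (hq0 k).le
  obtain ⟨z, hz⟩ := cauchySeq_tendsto_of_complete (cauchySeq_of_le_geometric_two hdist)
  have hzx : ∀ k, ‖z - x k‖ ≤ 1 := by
    intro k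
    have := dist_le_of_le_geometric_two_of_tendsto hdist hz k
    rw [dist_comm, dist_eq_norm] at this
    exact this.trans (div_le_self zero_le_one (one_le_pow₀ one_le_two))
  have hzC : z ∈ C := hC.mem_of_tendsto hz (Eventually.of_forall hxC)
  have hgz : ∀ k n, g k z ≤ g n (x n) := by
    intro k n
    refine le_of_tendsto (((hgcont k).tendsto z).comp hz) ?_
    filter_upwards [eventually_ge_atTop (max k n)] with m hm
    exact (hgmono (x m) (le_of_max_le_left hm)).trans (hanti (le_of_max_le_right hm))
  have hxb : ∀ k, ‖x k‖ ≤ ‖z‖ + 1 := fun k => by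
    have := norm_le_norm_add_norm_sub z (x k)
    linarith [hzx k]
  have hsum1 : Summable fun k => q k • x k := by
    refine Summable.of_norm_bounded (hq1.summable.mul_right (‖z‖ + 1)) fun k => ?_
    rw [norm_smul, Real.norm_of_nonneg (hq0 k).le]
    exact mul_le_mul_of_nonneg_left (hxb k) (hq0 k).le
  have hsum2 : Summable fun k => q k * ‖x k‖ ^ 2 := by
    refine Summable.of_nonneg_of_le (fun k => mul_nonneg (hq0 k).le (sq_nonneg _)) (fun k => ?_)
      (hq1.summable.mul_right ((‖z‖ + 1) ^ 2))
    exact mul_le_mul_of_nonneg_left (pow_le_pow_left₀ (norm_nonneg _) (hxb k) 2) (hq0 k).le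
  obtain ⟨b, hb⟩ := hsum1
  obtain ⟨S, hS⟩ := hsum2
  have hquad : ∀ y, HasSum (fun k => c * q k * ‖y - x k‖ ^ 2)
      (c * (‖y - b‖ ^ 2 + (S - ‖b‖ ^ 2))) := by
    intro y
    have h1 : HasSum (fun k => inner ℝ y (q k • x k)) (inner ℝ y b) := (innerSL ℝ y).hasSum hb
    have h2 := (((hq1.mul_right (‖y‖ ^ 2)).sub (h1.mul_left 2)).add hS).mul_left c
    have e1 : ∀ k, c * q k * ‖y - x k‖ ^ 2 =
        c * (q k * ‖y‖ ^ 2 - 2 * inner ℝ y (q k • x k) + q k * ‖x k‖ ^ 2) := fun k => by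
      rw [norm_sub_sq_real, inner_smul_right]
      ring
    have e2 : c * (‖y - b‖ ^ 2 + (S - ‖b‖ ^ 2)) = c * (1 * ‖y‖ ^ 2 - 2 * inner ℝ y b + S) := by
      rw [norm_sub_sq_real]
      ring
    rw [e2]
    simpa only [e1] using h2
  have hlim : ∀ y, Tendsto (fun k => g k y) atTop
      (𝓝 (f y + c * (‖y - b‖ ^ 2 + (S - ‖b‖ ^ 2)))) := by
    intro y
    have h1 : ∀ k, g k y = f y + ∑ i ∈ Finset.range k, c * q i * ‖y - x i‖ ^ 2 := by
      intro k
      induction k with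
      | zero => simp [hg0]
      | succ k ih => rw [hgs, ih, Finset.sum_range_succ, add_assoc]
    simp only [h1]
    exact (hquad y).tendsto_sum_nat.const_add _
  refine ⟨b, z, hzC, ?_, fun y hy => ?_⟩
  · have h1 : HasSum (fun k => q k • (z - x k)) (z - b) := by
      simpa [smul_sub] using (hq1.smul_const z).sub hb
    refine h1.norm_le_of_bounded hq1 fun k => ?_
    rw [norm_smul, Real.norm_of_nonneg (hq0 k).le]
    exact mul_le_of_le_one_right (hq0 k).le (hzx k)
  · have hεt : Tendsto ε atTop (𝓝 0) := by
      simpa using ((hqt.const_mul c).mul (hqt.pow 2))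
    have h1 : ∀ n, f z + c * (‖z - b‖ ^ 2 + (S - ‖b‖ ^ 2)) ≤ g n y + ε n := fun n =>
      (le_of_tendsto (hlim z) (Eventually.of_forall fun k => hgz k n)).trans (hxmin n y hy)
    have h2 := ge_of_tendsto ((hlim y).add hεt) (Eventually.of_forall h1)
    simp only [Set.mem_ofPred_eq]
    linarith

theorem abs_norm_sub_sq_sub_le {H : Type*} [NormedAddCommGroup H] {y z b : H}
    (hzb : ‖z - b‖ ≤ 1) (hyz : ‖y - z‖ ≤ 1) :
    |‖y - b‖ ^ 2 - ‖z - b‖ ^ 2| ≤ 3 * ‖y - z‖ := by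
  have h1 : ‖y - b‖ ≤ ‖y - z‖ + ‖z - b‖ := norm_sub_le_norm_sub_add_norm_sub y z b
  have h2 : |‖y - b‖ - ‖z - b‖| ≤ ‖y - z‖ := by
    simpa using abs_norm_sub_norm_le (y - b) (z - b)
  have h3 : 0 ≤ ‖y - b‖ + ‖z - b‖ := by positivity
  rw [sq_sub_sq, abs_mul, abs_of_nonneg h3]
  exact mul_le_mul (by linarith) h2 (abs_nonneg _) (by norm_num)

theorem sqrt_sq_add_sq_le (δ a b : ℝ) :
    √(δ ^ 2 + a ^ 2) ≤ √(δ ^ 2 + b ^ 2) + |a - b| := by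
  have h0 : 0 ≤ δ ^ 2 + b ^ 2 := by positivity
  have h1 : |b| ≤ √(δ ^ 2 + b ^ 2) := Real.abs_le_sqrt (by nlinarith [sq_nonneg δ])
  refine Real.sqrt_le_iff.2 ⟨by positivity, ?_⟩
  have h2 : b * (a - b) ≤ √(δ ^ 2 + b ^ 2) * |a - b| :=
    (le_abs_self _).trans ((abs_mul b (a - b)).trans_le
      (mul_le_mul_of_nonneg_right h1 (abs_nonneg _)))
  nlinarith [Real.sq_sqrt h0, sq_abs (a - b)]

theorem exists_notMem_openSegment_subset {E : Type*} [NormedAddCommGroup E] [NormedSpace ℝ E]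
    {U : Set E} (hU : IsOpen U) {x p : E} (hx : x ∈ U) (hp : p ∉ U) :
    ∃ q ∉ U, openSegment ℝ x q ⊆ U ∧ ‖q - x‖ ≤ ‖p - x‖ := by
  let γ : ℝ → E := fun t => x + t • (p - x)
  have hγ : Continuous γ := by fun_prop
  have hcomp : IsCompact (Set.Icc (0 : ℝ) 1 ∩ γ ⁻¹' Uᶜ) :=
    isCompact_Icc.inter_right (hU.isClosed_compl.preimage hγ)
  obtain ⟨τ, ⟨hτ, hτU⟩, hleast⟩ := hcomp.exists_isLeast ⟨1, by simp, by simpa [γ] using hp⟩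
  refine ⟨γ τ, hτU, ?_, ?_⟩
  · rw [openSegment_eq_image']
    rintro _ ⟨s, hs, rfl⟩
    by_contra hsU
    have hτ0 : 0 < τ := by
      refine lt_of_le_of_ne hτ.1 fun h => hτU ?_
      simpa [γ, ← h] using hx
    have h1 : s * τ < τ := mul_lt_of_lt_one_left hτ0 hs.2
    have h2 : x + s • (γ τ - x) = γ (s * τ) := by simp [γ, smul_smul]
    refine h1.not_ge (hleast ⟨⟨mul_nonneg hs.1.le hτ.1, h1.le.trans hτ.2⟩, ?_⟩)
    rw [Set.mem_preimage, ← h2]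
    exact hsU
  · simp only [γ, add_sub_cancel_left]
    rw [norm_smul, Real.norm_of_nonneg hτ.1]
    exact mul_le_of_le_one_left (norm_nonneg _) hτ.2

section Viscosity

variable {H : Type*} [NormedAddCommGroup H] [InnerProductSpace ℝ H]

theorem fderiv_mem_superdiffR {f φ : H → ℝ} {z : H} (hφ : ContDiffAt ℝ 1 φ z)
    (h : IsLocalMax (fun x => f x - φ x) z) : fderiv ℝ φ z ∈ superdiffR f z := by
  obtain ⟨ψ, hψ, hψφ⟩ := exists_contDiff_eventuallyEq hφ
  refine ⟨ψ, hψ, hψφ.fderiv_eq, h.congr ?_⟩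
  filter_upwards [hψφ] with y hy
  rw [hy]

theorem norm_le_one_of_mem_superdiffR {f : H → ℝ} (hf : LipschitzWith 1 f) {x : H}
    {ζ : H →L[ℝ] ℝ} (hζ : ζ ∈ superdiffR f x) : ‖ζ‖ ≤ 1 := by
  obtain ⟨φ, hφ, rfl, hmax⟩ := hζ
  refine norm_le_of_eventually_ge (hφ.differentiable one_ne_zero x).hasFDerivAt zero_le_one ?_
  filter_upwards [hmax] with y hy
  have h1 := hf.dist_le_mul y x
  rw [Real.dist_eq, dist_eq_norm, NNReal.coe_one] at h1
  have h2 := neg_abs_le (f y - f x)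
  linarith

theorem one_le_norm_of_mem_subdiffR_infDist {F : Set H} (hF : F.Nonempty) {x : H}
    (hx : 0 < infDist x F) {ζ : H →L[ℝ] ℝ} (hζ : ζ ∈ subdiffR (fun y => infDist y F) x) :
    1 ≤ ‖ζ‖ := by
  obtain ⟨φ, hφ, rfl, hmin⟩ := hζ
  refine le_of_forall_pos_le_add fun ε hε => ?_
  set ζ := fderiv ℝ φ x
  have hd : HasFDerivAt φ ζ x := (hφ.differentiable one_ne_zero x).hasFDerivAt
  obtain ⟨r, hr, hball⟩ := Metric.eventually_nhds_iff_ball.1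
    (hmin.and ((hasFDerivAt_iff_isLittleO.1 hd).def (half_pos hε)))
  set t := min (r / 2) (infDist x F / 2)
  have ht0 : 0 < t := lt_min (by positivity) (by positivity)
  have htr : t < r := (min_le_left _ _).trans_lt (by linarith)
  have htx : t < infDist x F := (min_le_right _ _).trans_lt (by linarith)
  obtain ⟨p, hp, hpx⟩ := (infDist_lt_iff hF).1
    (lt_add_of_pos_right (infDist x F) (mul_pos (half_pos hε) ht0))
  have hdp : infDist x F ≤ dist x p := infDist_le_dist_of_mem hp
  have hn : 0 < ‖p - x‖ := by
    rw [← dist_eq_norm, dist_comm]; linarith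
  set v := ‖p - x‖⁻¹ • (p - x) with hv
  have hv1 : ‖v‖ = 1 := by
    rw [hv, norm_smul, norm_inv, norm_norm, inv_mul_cancel₀ hn.ne']
  have htv : ‖t • v‖ = t := by rw [norm_smul, hv1, mul_one, Real.norm_of_nonneg ht0.le]
  obtain ⟨h1, h2⟩ := hball (x + t • v) (by simpa [htv] using htr)
  have h3 : dist (x + t • v) p = dist x p - t := by
    have : x + t • v - p = -((1 - t * ‖p - x‖⁻¹) • (p - x)) := by
      rw [hv, smul_smul, sub_smul, one_smul]; abel
    rw [dist_eq_norm, this, norm_neg, norm_smul, Real.norm_of_nonneg, dist_comm x p,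
      dist_eq_norm p x, sub_mul, one_mul, inv_mul_cancel_right₀ hn.ne']
    rw [sub_nonneg, ← div_eq_mul_inv, div_le_one hn, ← dist_eq_norm, dist_comm]
    linarith
  have h4 : infDist (x + t • v) F ≤ dist x p - t := h3 ▸ infDist_le_dist_of_mem hp
  rw [add_sub_cancel_left, htv, Real.norm_eq_abs] at h2
  have h5 := neg_le_of_abs_le h2
  have h6 : -ζ (t • v) ≤ ‖ζ‖ * t := by
    have := (neg_le_abs (ζ (t • v))).trans (ζ.le_opNorm (t • v))
    rwa [htv] at this
  refine le_of_mul_le_mul_right ?_ ht0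
  linarith

variable [CompleteSpace H] {w : H → ℝ} {Ω : Set H}

/-- A viscosity subsolution of `‖dw‖ = 1` has pointwise slope at most one. -/
theorem eventually_sub_le_of_superdiffR (hw : Continuous w) (hΩo : IsOpen Ω)
    (hsup : ∀ x ∈ Ω, ∀ ζ ∈ superdiffR w x, ‖ζ‖ ≤ 1) {x : H} (hx : x ∈ Ω) {L : ℝ} (hL : 1 < L) :
    ∀ᶠ y in 𝓝 x, w y - w x ≤ L * ‖y - x‖ := by
  obtain ⟨L', hL'1, hL'⟩ := exists_between hL
  obtain ⟨ρ, hρ, hball⟩ := Metric.nhds_basis_closedBall.eventually_iff.1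
    ((hΩo.eventually_mem hx).and (hw.continuousAt.eventually_lt continuousAt_const
      (lt_add_one (w x))))
  set K := 1 / ρ ^ 2 with hK
  have hK0 : 0 < K := by positivity
  let f : H → ℝ := fun y => -w y + (L' * ‖y - x‖ + K * ‖y - x‖ ^ 2)
  have hfc : Continuous f := by fun_prop
  have hfx : f x = -w x := by simp [f]
  have key : ∀ y ∈ closedBall x ρ, f x ≤ f y := by
    intro y hy
    by_contra! hlt
    obtain ⟨c, hc0, hc⟩ : ∃ c, 0 < c ∧ c < min ((L' - 1) / 3) ((f x - f y) / (2 * ρ + 1) ^ 2) :=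
      exists_between (lt_min (by linarith) (div_pos (by linarith) (by positivity)))
    have hc1 : 3 * c < L' - 1 := by linarith [lt_min_iff.1 hc]
    have hc2 : c * (2 * ρ + 1) ^ 2 < f x - f y :=
      (lt_div_iff₀ (by positivity)).1 (lt_min_iff.1 hc).2
    have hbdd : BddBelow (f '' closedBall x ρ) := by
      refine ⟨-(w x + 1), ?_⟩
      rintro _ ⟨z, hz, rfl⟩
      have h1 := (hball hz).2
      have h2 : 0 ≤ L' * ‖z - x‖ + K * ‖z - x‖ ^ 2 := by positivity
      simp only [f]
      linarith
    obtain ⟨b, z, hz, hzb, hmin⟩ := exists_isMinOn_add_const_mul_norm_sub_sq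
      isClosed_closedBall ⟨y, hy⟩ hfc hbdd hc0
    have hfz : f z < f x := by
      have h1 : f z + c * ‖z - b‖ ^ 2 ≤ f y + c * ‖y - b‖ ^ 2 := hmin hy
      have h2 : ‖y - b‖ ≤ 2 * ρ + 1 := by
        have h3 := norm_sub_le_norm_sub_add_norm_sub y z b
        have h4 := dist_triangle_right y z x
        rw [mem_closedBall] at hy hz
        rw [← dist_eq_norm y z] at h3
        linarith
      have h3 : ‖y - b‖ ^ 2 ≤ (2 * ρ + 1) ^ 2 := pow_le_pow_left₀ (norm_nonneg _) h2 2
      have h4 := mul_le_mul_of_nonneg_left h3 hc0.le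
      have h5 : 0 ≤ c * ‖z - b‖ ^ 2 := by positivity
      linarith
    have hzx : z - x ≠ 0 := by
      rintro h
      rw [sub_eq_zero.1 h] at hfz
      exact lt_irrefl _ hfz
    have hn : 0 < ‖z - x‖ := norm_pos_iff.2 hzx
    have hzball : z ∈ ball x ρ := by
      refine lt_of_le_of_ne (mem_closedBall.1 hz) fun h => ?_
      have h1 := (hball hz).2
      rw [dist_eq_norm] at h
      have h2 : K * ‖z - x‖ ^ 2 = 1 := by
        rw [h, hK]
        field_simp
      have h3 : 0 ≤ L' * ‖z - x‖ := by positivity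
      rw [hfx] at hfz
      simp only [f] at hfz
      linarith
    let φ : H → ℝ := fun y => L' * ‖y - x‖ + K * ‖y - x‖ ^ 2 + c * ‖y - b‖ ^ 2
    have hφ : ContDiffAt ℝ 1 φ z := by
      have h1 : ContDiffAt ℝ 1 (fun y => ‖y - x‖) z :=
        (contDiffAt_id.sub contDiffAt_const).norm ℝ hzx
      have h2 : ContDiff ℝ 1 (fun y : H => ‖y - b‖ ^ 2) :=
        (contDiff_id.sub contDiff_const).norm_sq ℝ
      exact ((contDiffAt_const.mul h1).add (contDiffAt_const.mul (h1.pow 2))).add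
        (contDiffAt_const.mul h2.contDiffAt)
    have hmax : IsLocalMax (fun y => w y - φ y) z := by
      filter_upwards [isOpen_ball.mem_nhds hzball] with u hu
      have h1 : f z + c * ‖z - b‖ ^ 2 ≤ f u + c * ‖u - b‖ ^ 2 := hmin (ball_subset_closedBall hu)
      simp only [f] at h1
      simp only [φ]
      linarith
    have hle := hsup z (hball hz).1 _ (fderiv_mem_superdiffR hφ hmax)
    have hge : L' - 3 * c ≤ ‖fderiv ℝ φ z‖ := by
      have hv1 : ‖‖z - x‖⁻¹ • (z - x)‖ = 1 := by
        rw [norm_smul, norm_inv, norm_norm, inv_mul_cancel₀ hn.ne']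
      refine le_norm_of_eventually_le (hφ.differentiableAt one_ne_zero).hasFDerivAt hv1 ?_
      filter_upwards [Ioo_mem_nhdsGT zero_lt_one] with t ht
      have ht0 : 0 < t := ht.1
      set u := z + t • ‖z - x‖⁻¹ • (z - x) with hu
      have huz : ‖u - z‖ = t := by
        rw [hu, add_sub_cancel_left, norm_smul, hv1, mul_one, Real.norm_of_nonneg ht0.le]
      have hux : ‖u - x‖ = ‖z - x‖ + t := by
        have : u - x = (1 + t * ‖z - x‖⁻¹) • (z - x) := by
          rw [hu, smul_smul, add_smul, one_smul]; abel
        rw [this, norm_smul, Real.norm_of_nonneg (by positivity), add_mul, one_mul,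
          inv_mul_cancel_right₀ hn.ne']
      have h1 := neg_le_of_abs_le (abs_norm_sub_sq_sub_le hzb (huz.trans_le ht.2.le))
      rw [huz] at h1
      have h2 := mul_le_mul_of_nonneg_left h1 hc0.le
      have h3 : 0 ≤ K * ((‖z - x‖ + t) ^ 2 - ‖z - x‖ ^ 2) := by
        have : (‖z - x‖ + t) ^ 2 - ‖z - x‖ ^ 2 = t * (2 * ‖z - x‖ + t) := by ring
        rw [this]
        positivity
      simp only [φ]
      rw [hux]
      linarith
    linarith
  have hsmall : ∀ᶠ y in 𝓝 x, K * ‖y - x‖ < L - L' := by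
    have : Continuous fun y => K * ‖y - x‖ := by fun_prop
    exact this.continuousAt.eventually_lt continuousAt_const (by simpa using hL')
  filter_upwards [hsmall, closedBall_mem_nhds x hρ] with y hy hyρ
  have h1 := key y hyρ
  rw [hfx] at h1
  simp only [f] at h1
  have h2 := mul_le_mul_of_nonneg_right hy.le (norm_nonneg (y - x))
  linarith

theorem sub_le_norm_sub_of_openSegment_subset (hw : Continuous w) (hΩo : IsOpen Ω)
    (hsup : ∀ x ∈ Ω, ∀ ζ ∈ superdiffR w x, ‖ζ‖ ≤ 1) {x y : H} (hxy : openSegment ℝ x y ⊆ Ω) :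
    w y - w x ≤ ‖y - x‖ := by
  rcases eq_or_ne y x with rfl | hne
  · simp
  have hn : 0 < ‖y - x‖ := norm_pos_iff.2 (sub_ne_zero.2 hne)
  let γ : ℝ → H := fun t => x + t • (y - x)
  have hγ : Continuous γ := by fun_prop
  have hγΩ : ∀ t ∈ Set.Ioo (0 : ℝ) 1, γ t ∈ Ω := fun t ht =>
    hxy (openSegment_eq_image' ℝ x y ▸ ⟨t, ht, rfl⟩)
  have hγsub : ∀ s t : ℝ, t < s → ‖γ s - γ t‖ = (s - t) * ‖y - x‖ := fun s t hst => by
    have : γ s - γ t = (s - t) • (y - x) := by simp only [γ, sub_smul]; abel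
    rw [this, norm_smul, Real.norm_of_nonneg (by linarith)]
  have key : ∀ s ∈ Set.Ioo (0 : ℝ) 1, w (γ 1) ≤ w (γ s) + (1 - s) * ‖y - x‖ := by
    intro s hs
    refine image_le_of_liminf_slope_right_le_deriv_boundary (f := w ∘ γ) (a := s) (b := 1)
      (B := fun t => w (γ s) + (t - s) * ‖y - x‖) (B' := fun _ => ‖y - x‖)
      (hw.comp hγ).continuousOn (by simp) (by fun_prop) ?_ ?_ (Set.right_mem_Icc.2 hs.2.le)
    · intro t _
      simpa using ((((hasDerivAt_id t).sub_const s).mul_const ‖y - x‖).const_add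
        (w (γ s))).hasDerivWithinAt
    · intro t ht r hr
      have htΩ := hγΩ t ⟨hs.1.trans_le ht.1, ht.2⟩
      obtain ⟨L, hL1, hL⟩ := exists_between ((one_lt_div hn).2 hr)
      rw [lt_div_iff₀ hn] at hL
      have h1 := (hγ.tendsto t).eventually (eventually_sub_le_of_superdiffR hw hΩo hsup htΩ hL1)
      refine Eventually.frequently ?_
      filter_upwards [h1.filter_mono nhdsWithin_le_nhds, self_mem_nhdsWithin] with u hu htu
      have htu : t < u := htu
      rw [hγsub u t htu] at hu
      rw [slope_def_field, div_lt_iff₀ (by linarith)]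
      have := mul_lt_mul_of_pos_right hL (sub_pos.2 htu)
      simp only [Function.comp]
      linarith
  have hlim : Tendsto (fun s => w (γ s) + (1 - s) * ‖y - x‖) (𝓝[>] 0) (𝓝 (w x + ‖y - x‖)) := by
    have : Continuous fun s => w (γ s) + (1 - s) * ‖y - x‖ := by fun_prop
    simpa [γ] using (this.tendsto 0).mono_left nhdsWithin_le_nhds
  have hfin : w (γ 1) ≤ w x + ‖y - x‖ := by
    refine ge_of_tendsto hlim ?_
    filter_upwards [Ioo_mem_nhdsGT zero_lt_one] with s hs using key s hs
  have hγ1 : γ 1 = y := by simp [γ]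
  rw [hγ1] at hfin
  linarith

theorem abs_le_infDist_frontier (hw : Continuous w) (hΩo : IsOpen Ω)
    (hfr : (frontier Ω).Nonempty) (hw0 : ∀ x ∉ Ω, w x = 0)
    (hsup : ∀ x ∈ Ω, ∀ ζ ∈ superdiffR w x, ‖ζ‖ ≤ 1) {x : H} (hx : x ∈ Ω) :
    |w x| ≤ infDist x (frontier Ω) := by
  refine (le_infDist hfr).2 fun p hp => ?_
  have hpΩ : p ∉ Ω := (hΩo.frontier_eq ▸ hp).2
  obtain ⟨q, hq, hseg, hle⟩ := exists_notMem_openSegment_subset hΩo hx hpΩ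
  have h1 := sub_le_norm_sub_of_openSegment_subset hw hΩo hsup hseg
  have h2 := sub_le_norm_sub_of_openSegment_subset hw hΩo hsup
    (openSegment_symm ℝ x q ▸ hseg)
  rw [hw0 q hq] at h1 h2
  rw [norm_sub_rev x q] at h2
  rw [dist_comm, dist_eq_norm, abs_le]
  constructor <;> linarith

/-- A viscosity supersolution of `‖dw‖ = 1` vanishing outside `Ω` dominates the distance to the
frontier. -/
theorem infDist_frontier_le_of_subdiffR (hw : Continuous w) (hΩo : IsOpen Ω)
    (hΩb : Bornology.IsBounded Ω) (hbdd : BddBelow (w '' closure Ω)) (hw0 : ∀ x ∉ Ω, w x = 0)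
    (hsub : ∀ x ∈ Ω, ∀ ζ ∈ subdiffR w x, 1 ≤ ‖ζ‖) {x : H} (hx : x ∈ Ω) :
    infDist x (frontier Ω) ≤ w x := by
  set d := infDist x (frontier Ω)
  set D := diam (closure Ω)
  have key : ∀ η ∈ Set.Ioo (0 : ℝ) (1 / 4),
      (1 - 4 * η) * d ≤ w x + (1 - 4 * η) * η + η * (D + 1) ^ 2 := by
    rintro η ⟨hη0, hη1⟩
    have hθ : 0 ≤ 1 - 4 * η := by linarith
    set θ := 1 - 4 * η with hθdef
    let f : H → ℝ := fun y => w y + θ * √(η ^ 2 + ‖y - x‖ ^ 2)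
    have hfc : Continuous f := by fun_prop
    have hfbdd : BddBelow (f '' closure Ω) := by
      obtain ⟨m, hm⟩ := hbdd
      refine ⟨m, ?_⟩
      rintro _ ⟨y, hy, rfl⟩
      have h1 := hm ⟨y, hy, rfl⟩
      have h2 : 0 ≤ θ * √(η ^ 2 + ‖y - x‖ ^ 2) := by positivity
      simp only [f]
      linarith
    obtain ⟨b, z, hz, hzb, hmin⟩ := exists_isMinOn_add_const_mul_norm_sub_sq
      isClosed_closure ⟨x, subset_closure hx⟩ hfc hfbdd hη0
    have hzΩ : z ∉ Ω := by
      intro hzΩ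
      let φ : H → ℝ := fun y => -(θ * √(η ^ 2 + ‖y - x‖ ^ 2) + η * ‖y - b‖ ^ 2)
      have hφ : ContDiff ℝ 1 φ := by
        have h1 : ∀ a : H, ContDiff ℝ 1 (fun y : H => ‖y - a‖ ^ 2) := fun a =>
          (contDiff_id.sub contDiff_const).norm_sq ℝ
        exact ((contDiff_const.mul ((contDiff_const.add (h1 x)).sqrt
          fun y => by positivity)).add (contDiff_const.mul (h1 b))).neg
      have hloc : IsLocalMin (fun y => w y - φ y) z := by
        filter_upwards [hΩo.mem_nhds hzΩ] with u hu
        have h1 : f z + η * ‖z - b‖ ^ 2 ≤ f u + η * ‖u - b‖ ^ 2 := hmin (subset_closure hu)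
        simp only [f] at h1
        simp only [φ]
        linarith
      have hge := hsub z hzΩ _ ⟨φ, hφ, rfl, hloc⟩
      have hle : ‖fderiv ℝ φ z‖ ≤ θ + 3 * η := by
        refine norm_le_of_eventually_ge (hφ.differentiable one_ne_zero z).hasFDerivAt
          (by positivity) ?_
        filter_upwards [closedBall_mem_nhds z zero_lt_one] with y hy
        rw [mem_closedBall, dist_eq_norm] at hy
        have h1 := (le_abs_self _).trans (abs_norm_sub_sq_sub_le hzb hy)
        have h2 := mul_le_mul_of_nonneg_left h1 hη0.le
        have h3 := sqrt_sq_add_sq_le η ‖y - x‖ ‖z - x‖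
        have h4 : |‖y - x‖ - ‖z - x‖| ≤ ‖y - z‖ := by
          simpa using abs_norm_sub_norm_le (y - x) (z - x)
        have h5 := mul_le_mul_of_nonneg_left (h3.trans (add_le_add_right h4 _)) hθ
        simp only [φ]
        linarith
      linarith
    have h1 : f z + η * ‖z - b‖ ^ 2 ≤ f x + η * ‖x - b‖ ^ 2 := hmin (subset_closure hx)
    simp only [f, hw0 z hzΩ, sub_self, norm_zero] at h1
    rw [zero_pow two_ne_zero, add_zero, Real.sqrt_sq hη0.le] at h1
    have h2 : d ≤ ‖z - x‖ := by
      rw [← dist_eq_norm, dist_comm]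
      exact infDist_le_dist_of_mem (hΩo.frontier_eq ▸ ⟨hz, hzΩ⟩)
    have h3 : ‖z - x‖ ≤ √(η ^ 2 + ‖z - x‖ ^ 2) :=
      Real.le_sqrt_of_sq_le (by nlinarith [sq_nonneg η])
    have h4 := mul_le_mul_of_nonneg_left (h2.trans h3) hθ
    have h5 : ‖x - b‖ ≤ D + 1 := by
      have h6 := norm_sub_le_norm_sub_add_norm_sub x z b
      have h7 := dist_le_diam_of_mem hΩb.closure (subset_closure hx) hz
      rw [dist_eq_norm] at h7
      linarith
    have h6 := mul_le_mul_of_nonneg_left (pow_le_pow_left₀ (norm_nonneg _) h5 2) hη0.le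
    have h7 : 0 ≤ η * ‖z - b‖ ^ 2 := by positivity
    linarith
  have hl : Tendsto (fun η : ℝ => (1 - 4 * η) * d) (𝓝[>] 0) (𝓝 d) := by
    have : Continuous fun η : ℝ => (1 - 4 * η) * d := by fun_prop
    simpa using (this.tendsto 0).mono_left nhdsWithin_le_nhds
  have hr : Tendsto (fun η : ℝ => w x + (1 - 4 * η) * η + η * (D + 1) ^ 2) (𝓝[>] 0)
      (𝓝 (w x)) := by
    have : Continuous fun η : ℝ => w x + (1 - 4 * η) * η + η * (D + 1) ^ 2 := by fun_prop
    simpa using (this.tendsto 0).mono_left nhdsWithin_le_nhds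
  refine le_of_tendsto_of_tendsto hl hr ?_
  filter_upwards [Ioo_mem_nhdsGT (show (0 : ℝ) < 1 / 4 by norm_num)] with η hη using key η hη

end Viscosity

/-- The distance to the boundary of a nonempty bounded open set `Ω` in a nontrivial real
Hilbert space is the unique viscosity solution of the eikonal equation `‖du‖ = 1` on `Ω`,
`u = 0` on `∂Ω`. -/
theorem eikonal_distance_to_boundary
    {H : Type*} [NormedAddCommGroup H] [InnerProductSpace ℝ H] [CompleteSpace H] [Nontrivial H]
    (Ω : Set H) (hΩo : IsOpen Ω) (hΩne : Ω.Nonempty) (hΩb : Bornology.IsBounded Ω) :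
    Continuous (fun x : H => infDist x (frontier Ω)) ∧
    (∀ x ∈ frontier Ω, infDist x (frontier Ω) = 0) ∧
    (∀ x ∈ Ω,
      (∀ ζ ∈ subdiffR (fun y : H => infDist y (frontier Ω)) x, 1 ≤ ‖ζ‖) ∧
      (∀ ζ ∈ superdiffR (fun y : H => infDist y (frontier Ω)) x, ‖ζ‖ ≤ 1)) ∧
    (∀ w : H → ℝ, Continuous w → (∀ x ∉ Ω, w x = 0) →
      (∀ x ∈ Ω, ∀ ζ ∈ subdiffR w x, 1 ≤ ‖ζ‖) →
      (∀ x ∈ Ω, ∀ ζ ∈ superdiffR w x, ‖ζ‖ ≤ 1) →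
      ∀ x ∈ closure Ω, w x = infDist x (frontier Ω)) := by
  have hfr : (frontier Ω).Nonempty := by
    refine nonempty_frontier_iff.2 ⟨hΩne, ?_⟩
    rintro rfl
    exact NormedSpace.unbounded_univ ℝ H hΩb
  have hpos : ∀ x ∈ Ω, 0 < infDist x (frontier Ω) := fun x hx =>
    (isClosed_frontier.notMem_iff_infDist_pos hfr).1 fun h => (hΩo.frontier_eq ▸ h).2 hx
  refine ⟨continuous_infDist_pt _, fun x hx => infDist_zero_of_mem hx, fun x hx =>
    ⟨fun ζ hζ => one_le_norm_of_mem_subdiffR_infDist hfr (hpos x hx) hζ,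
      fun ζ hζ => norm_le_one_of_mem_superdiffR (lipschitz_infDist_pt _) hζ⟩, ?_⟩
  intro w hw hw0 hsub hsup x hx
  by_cases hxΩ : x ∈ Ω
  · have habs : ∀ y ∈ Ω, |w y| ≤ infDist y (frontier Ω) := fun y hy =>
      abs_le_infDist_frontier hw hΩo hfr hw0 hsup hy
    refine le_antisymm ((le_abs_self _).trans (habs x hxΩ))
      (infDist_frontier_le_of_subdiffR hw hΩo hΩb ⟨-diam (closure Ω), ?_⟩ hw0 hsub hxΩ)
    rintro _ ⟨y, hy, rfl⟩
    by_cases hyΩ : y ∈ Ω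
    · obtain ⟨p, hp⟩ := hfr
      have h1 := dist_le_diam_of_mem hΩb.closure hy (frontier_subset_closure hp)
      have h2 := (habs y hyΩ).trans ((infDist_le_dist_of_mem hp).trans h1)
      exact neg_le_of_abs_le h2
    · rw [hw0 y hyΩ]
      exact neg_nonpos.2 diam_nonneg
  · rw [hw0 x hxΩ, infDist_zero_of_mem (hΩo.frontier_eq ▸ ⟨hx, hxΩ⟩)]
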